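/- Let K be the fraction field of a discrete valuation ring R, and T a reduced scheme of finite type over a field L₀. Then T(L₀^sep) is dense in T if and only if T is geometrically reduced over L₀. (Voloch's lemma.) -/

import Mathlib

open TensorProduct

universe u

lemma Localization.Away.nontrivial_of_notMem {A : Type*} [CommRing A] {f : A} (p : Ideal A)
    [p.IsPrime] (hf : f ∉ p) : Nontrivial (Localization.Away f) := by
  rw [← not_subsingleton_iff_nontrivial, IsLocalization.subsingleton_iff (M := .powers f)]
  rintro ⟨k, hk⟩
  exact hf (Ideal.IsPrime.mem_of_pow_mem ‹_› k ((show f ^ k = 0 from hk) ▸ p.zero_mem))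

lemma IsSepClosed.infinite (F : Type*) [Field F] [IsSepClosed F] : Infinite F := by
  by_contra h
  rw [not_infinite_iff_finite] at h
  have : IsAlgClosed F := inferInstance
  exact (IsAlgClosed.instInfinite (K := F)).not_finite h

/-- A nonzero smooth algebra over a separably closed field has a rational point. -/
lemma Algebra.Smooth.nonempty_algHom_of_isSepClosed (F B : Type*) [Field F] [IsSepClosed F]
    [CommRing B] [Algebra F B] [Algebra.Smooth F B] [Nontrivial B] : Nonempty (B →ₐ[F] F) := by
  have := IsSepClosed.infinite F
  obtain ⟨p, hp⟩ := Ideal.exists_maximal B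
  obtain ⟨f, hfp, n, _, _, _⟩ :=
    Algebra.IsSmoothAt.exists_isStandardEtale_mvPolynomial (R := F) (p := p)
  let S := Localization.Away f
  let P := MvPolynomial (Fin n) F
  have : Nontrivial S := Localization.Away.nontrivial_of_notMem p hfp
  have hopen := PrimeSpectrum.isOpenMap_comap_of_hasGoingDown_of_finitePresentation
    (R := P) (S := S) Set.univ isOpen_univ
  obtain ⟨y⟩ : Nonempty (PrimeSpectrum S) := inferInstance
  obtain ⟨_, ⟨_, ⟨g, rfl⟩, rfl⟩, hyg, hg⟩ :=
    PrimeSpectrum.isBasis_basic_opens.exists_subset_of_mem_open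
      (Set.mem_image_of_mem _ (Set.mem_univ y)) hopen
  have hg0 : g ≠ 0 := by
    rintro rfl
    simp at hyg
  obtain ⟨v, hv⟩ : ∃ v, MvPolynomial.eval v g ≠ 0 := by
    by_contra! h
    exact hg0 (MvPolynomial.funext (by simpa using h))
  obtain ⟨q, -, hq⟩ := hg (show (⟨RingHom.ker (MvPolynomial.eval v), RingHom.ker_isPrime _⟩ :
    PrimeSpectrum P) ∈ _ from hv)
  have hq' (x : P) (hx : MvPolynomial.eval v x = 0) : algebraMap P S x ∈ q.asIdeal := by
    have : x ∈ (PrimeSpectrum.comap (algebraMap P S) q).asIdeal := by rw [hq]; exact hx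
    exact this
  let : Algebra P F := (MvPolynomial.eval v).toAlgebra
  have : IsScalarTower P F (S ⧸ q.asIdeal) := by
    refine .of_algebraMap_eq fun x ↦ ?_
    have := hq' (x - MvPolynomial.C (MvPolynomial.eval v x)) (by simp)
    rw [map_sub, ← Ideal.Quotient.eq] at this
    refine this.trans ?_
    change Ideal.Quotient.mk _ (algebraMap P S (algebraMap F P _)) = _
    rw [← IsScalarTower.algebraMap_apply F P S]
    rfl
  have : Algebra.FormallyUnramified P (S ⧸ q.asIdeal) := .comp P S _
  have : Algebra.FormallyUnramified F (S ⧸ q.asIdeal) := .of_restrictScalars P _ _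
  have : Algebra.FiniteType F S := .trans (S := B) inferInstance inferInstance
  have : Module.Finite F (S ⧸ q.asIdeal) := Algebra.FormallyUnramified.finite_of_free _ _
  let : Field (S ⧸ q.asIdeal) :=
    { (isField_of_isIntegral_of_isField' (Field.toIsField F) :
        IsField (S ⧸ q.asIdeal)).toField with }
  have : Algebra.IsSeparable F (S ⧸ q.asIdeal) := Algebra.FormallyUnramified.isSeparable _ _
  let e := AlgEquiv.ofBijective (Algebra.ofId F (S ⧸ q.asIdeal))
    (IsSepClosed.algebraMap_bijective _ _)
  exact ⟨(e.symm.toAlgHom.comp (Ideal.Quotient.mkₐ F q.asIdeal)).comp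
    (IsScalarTower.toAlgHom F B S)⟩

/-- Separable algebraic extensions are geometrically reduced. -/
lemma Algebra.IsGeometricallyReduced.of_isSeparable (k L : Type*) [Field k] [Field L]
    [Algebra k L] [Algebra.IsSeparable k L] : Algebra.IsGeometricallyReduced k L := by
  refine .of_forall_fg fun B hB ↦ ?_
  have : Algebra.FiniteType k B := B.fg_iff_finiteType.mp hB
  have : Algebra.IsIntegral k B := .of_injective B.val Subtype.val_injective
  let : Field B :=
    { (isField_of_isIntegral_of_isField' (Field.toIsField k) : IsField B).toField with }
  have : Algebra.IsSeparable k B := .of_algHom k L B.val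
  have : Algebra.FormallyEtale k B := .of_isSeparable k B
  rw [Algebra.isGeometricallyReduced_field_iff]
  exact Algebra.FormallyUnramified.isReduced_of_field (AlgebraicClosure k) _

/-- An algebra over a field is geometrically reduced if its elements are separated by
homomorphisms to a geometrically reduced algebra. -/
lemma Algebra.IsGeometricallyReduced.of_forall_algHom {k A : Type*} (L : Type*) [Field k]
    [CommRing A] [Algebra k A] [CommRing L] [Algebra k L] [Algebra.IsGeometricallyReduced k L]
    (h : ∀ a : A, (∀ φ : A →ₐ[k] L, φ a = 0) → a = 0) : Algebra.IsGeometricallyReduced k A := by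
  rw [Algebra.isGeometricallyReduced_field_iff]
  refine ⟨fun x hx ↦ ?_⟩
  let b := Module.Free.chooseBasis k (AlgebraicClosure k)
  obtain ⟨c, rfl⟩ := TensorProduct.eq_repr_basis_left b x
  suffices c = 0 by simp [this]
  ext i
  refine h _ fun φ ↦ ?_
  have hφ := (hx.map (Algebra.TensorProduct.map (AlgHom.id k (AlgebraicClosure k)) φ)).eq_zero
  have := TensorProduct.sum_tmul_basis_left_eq_zero b (c.mapRange φ (map_zero φ)) (by
    rw [Finsupp.sum_mapRange_index (by simp)]
    simpa [Finsupp.sum, map_sum] using hφ)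
  simpa using DFunLike.congr_fun this i

/-- Localizations of geometrically reduced algebras are geometrically reduced. -/
lemma Algebra.IsGeometricallyReduced.of_isLocalization (k : Type*) {A : Type u} (B : Type u)
    [Field k] [CommRing A] [CommRing B] [Algebra k A] [Algebra k B] [Algebra A B]
    [IsScalarTower k A B] (M : Submonoid A) [IsLocalization M B]
    [Algebra.IsGeometricallyReduced k A] : Algebra.IsGeometricallyReduced k B := by
  rw [Algebra.isGeometricallyReduced_field_iff]
  let f := Algebra.TensorProduct.map (AlgHom.id (AlgebraicClosure k) (AlgebraicClosure k))
    (IsScalarTower.toAlgHom k A B)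
  let := f.toAlgebra
  have : IsScalarTower (AlgebraicClosure k) (AlgebraicClosure k ⊗[k] A)
      (AlgebraicClosure k ⊗[k] B) := .of_algebraMap_eq' f.comp_algebraMap.symm
  have := IsLocalization.tensorProduct_tensorProduct_right (R := k) (S := AlgebraicClosure k) M B
    (by ext x; simp [RingHom.algebraMap_toAlgebra, f])
  exact isReduced_localizationPreserves (M.map (Algebra.TensorProduct.includeRight (R := k)
    (A := AlgebraicClosure k) (B := A))) (AlgebraicClosure k ⊗[k] B) inferInstance

/-- Finitely generated geometrically reduced field extensions are separably generated. -/
lemma Algebra.IsGeometricallyReduced.exists_isTranscendenceBasis_and_isSeparable (k K : Type*)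
    [Field k] [Field K] [Algebra k K] [Algebra.EssFiniteType k K]
    [Algebra.IsGeometricallyReduced k K] :
    ∃ s : Finset K, IsTranscendenceBasis k ((↑) : s → K) ∧
      Algebra.IsSeparable (IntermediateField.adjoin k (s : Set K)) K := by
  obtain _ | ⟨p, hp, hpk⟩ := CharP.exists' k
  · exact exists_isTranscendenceBasis_and_isSeparable_of_perfectField k K
  refine exists_isTranscendenceBasis_and_isSeparable_of_linearIndepOn_pow_of_essFiniteType
    p hp.out fun s hs ↦ ?_
  have : CharP (AlgebraicClosure k) p := charP_of_injective_algebraMap' k p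
  have : CharP (AlgebraicClosure k ⊗[k] K) p :=
    charP_of_injective_algebraMap (algebraMap (AlgebraicClosure k) _).injective p
  rw [LinearIndepOn, Fintype.linearIndependent_iff]
  intro c hc i
  have hs' : LinearIndependent (AlgebraicClosure k)
    (fun i : (s : Set K) ↦ (1 : AlgebraicClosure k) ⊗ₜ[k] (i : K)) :=
    Module.Flat.linearIndependent_one_tmul hs
  choose d hd using fun i ↦
    IsAlgClosed.exists_pow_nat_eq (algebraMap k (AlgebraicClosure k) (c i)) hp.out.pos
  have key : (∑ i, d i • ((1 : AlgebraicClosure k) ⊗ₜ[k] (i : K))) ^ p = 0 := by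
    rw [sum_pow_char p]
    trans (1 : AlgebraicClosure k) ⊗ₜ[k] (∑ i, c i • (i : K) ^ p)
    · simp [TensorProduct.tmul_sum, TensorProduct.smul_tmul', hd,
        Algebra.algebraMap_eq_smul_one]
    · rw [hc, tmul_zero]
  have := Fintype.linearIndependent_iff.mp hs' d (pow_eq_zero_iff hp.out.ne_zero |>.mp key) i
  refine (map_eq_zero (algebraMap k (AlgebraicClosure k))).mp ?_
  rw [← hd i, this, zero_pow hp.out.ne_zero]

/-- Finitely generated geometrically reduced field extensions are formally smooth. -/
lemma Algebra.IsGeometricallyReduced.formallySmooth (k K : Type*)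
    [Field k] [Field K] [Algebra k K] [Algebra.EssFiniteType k K]
    [Algebra.IsGeometricallyReduced k K] : Algebra.FormallySmooth k K := by
  obtain ⟨s, hs, H⟩ :=
    Algebra.IsGeometricallyReduced.exists_isTranscendenceBasis_and_isSeparable k K
  have : Algebra.IsSeparable (IntermediateField.adjoin k (Set.range ((↑) : s → K))) K := by
    convert! H <;> simp
  exact .of_algebraicIndependent_of_isSeparable hs.1

/-- Geometrically reduced algebras are smooth at their generic points. -/
lemma Algebra.IsGeometricallyReduced.isSmoothAt_of_mem_minimalPrimes (k : Type*) {A : Type*}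
    [Field k] [CommRing A] [Algebra k A] [Algebra.EssFiniteType k A]
    [Algebra.IsGeometricallyReduced k A] (p : Ideal A) [p.IsPrime] (hp : p ∈ minimalPrimes A) :
    Algebra.IsSmoothAt k p := by
  have := Algebra.IsGeometricallyReduced.of_isLocalization k (Localization.AtPrime p) p.primeCompl
  have := Algebra.isReduced_of_isGeometricallyReduced k (A := A)
  have : Ring.KrullDimLE 0 (Localization.AtPrime p) := .of_isLocalization _ hp _
  let : Field (Localization.AtPrime p) :=
    { Ring.KrullDimLE.isField_of_isReduced.toField with }
  have : Algebra.EssFiniteType A (Localization.AtPrime p) := .of_isLocalization _ p.primeCompl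
  have : Algebra.EssFiniteType k (Localization.AtPrime p) := .comp _ A _
  exact Algebra.IsGeometricallyReduced.formallySmooth k (Localization.AtPrime p)

/-- Voloch's lemma (affine version): let `T = Spec A` be a reduced scheme of finite type
over a field `L₀`.  Then the set of points of `T` coming from `L₀^sep`-valued points is
dense in `T` if and only if `T` is geometrically reduced over `L₀`. -/
theorem stmt8 (L₀ : Type*) [Field L₀] (A : Type*) [CommRing A] [Algebra L₀ A]
    [Algebra.FiniteType L₀ A] [IsReduced A] :
    Dense {x : PrimeSpectrum A |
        ∃ φ : A →ₐ[L₀] SeparableClosure L₀, x.asIdeal = RingHom.ker φ} ↔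
      IsReduced ((AlgebraicClosure L₀) ⊗[L₀] A) := by
  rw [← Algebra.isGeometricallyReduced_field_iff]
  constructor
  · intro h
    have := Algebra.IsGeometricallyReduced.of_isSeparable L₀ (SeparableClosure L₀)
    refine .of_forall_algHom (SeparableClosure L₀) fun a ha ↦ ?_
    by_contra ha0
    obtain ⟨x, hxa, φ, hφ⟩ := h.inter_open_nonempty _ (PrimeSpectrum.basicOpen a).isOpen (by
      rwa [← TopologicalSpace.Opens.ne_bot_iff_nonempty, ne_eq, PrimeSpectrum.basicOpen_eq_bot_iff,
        isNilpotent_iff_eq_zero])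
    exact hxa (hφ ▸ ha φ)
  · intro _
    rw [dense_iff_inter_open]
    rintro U hU ⟨x, hx⟩
    have : Algebra.FinitePresentation L₀ A := Algebra.FinitePresentation.of_finiteType.mp ‹_›
    obtain ⟨p, hp, hpx⟩ := Ideal.exists_minimalPrimes_le (bot_le : ⊥ ≤ x.asIdeal)
    have hp' : p.IsPrime := hp.1.1
    have hpU : (⟨p, hp'⟩ : PrimeSpectrum A) ∈ U :=
      ((PrimeSpectrum.le_iff_specializes ⟨p, hp'⟩ x).mp hpx).mem_open hU hx
    obtain ⟨_, ⟨_, ⟨f, rfl⟩, rfl⟩, hpf, hf⟩ :=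
      PrimeSpectrum.isBasis_basic_opens.exists_subset_of_mem_open
        (show ⟨p, hp'⟩ ∈ U ∩ Algebra.smoothLocus L₀ A from
          ⟨hpU, Algebra.IsGeometricallyReduced.isSmoothAt_of_mem_minimalPrimes L₀ p hp⟩)
        (hU.inter Algebra.isOpen_smoothLocus)
    have := Algebra.basicOpen_subset_smoothLocus_iff_smooth.mp (hf.trans Set.inter_subset_right)
    have : Nontrivial (Localization.Away f) :=
      Localization.Away.nontrivial_of_notMem p hpf
    obtain ⟨ψ⟩ := Algebra.Smooth.nonempty_algHom_of_isSepClosed (SeparableClosure L₀)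
      (SeparableClosure L₀ ⊗[L₀] Localization.Away f)
    let χ : Localization.Away f →ₐ[L₀] SeparableClosure L₀ :=
      (ψ.restrictScalars L₀).comp Algebra.TensorProduct.includeRight
    let φ := χ.comp (IsScalarTower.toAlgHom L₀ A (Localization.Away f))
    have hφ : φ f ≠ 0 := ((IsLocalization.Away.algebraMap_isUnit f).map χ).ne_zero
    exact ⟨⟨RingHom.ker φ, RingHom.ker_isPrime _⟩, (hf hφ).1, φ, rfl⟩
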